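/- Let f ∈ L¹(𝕋). (i) If ∫_𝕋 |f(θ)| log⁺ log⁺ |f(θ)| dθ < ∞, then ∫_𝕋 Ψ₀(f*(θ)) dθ < ∞, i.e. f ∈ H^log(𝕋). (ii) Conversely, if f ≥ 0 almost everywhere on 𝕋 and ∫_𝕋 Ψ₀(f*(θ)) dθ < ∞, then ∫_𝕋 f(θ) log⁺ log⁺ f(θ) dθ < ∞. In particular, the nonnegative elements of H^log(𝕋) ∩ L¹(𝕋) are exactly the nonnegative elements of L log log L(𝕋). -/

import Mathlib

open MeasureTheory Real Set ENNReal

noncomputable section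

/-- `log⁺ s = max (log s) 0`. -/
def logPlus (s : ℝ) : ℝ := max (Real.log s) 0

/-- `Ψ₀(t) = t / log(e+t)`, on `[0,∞]` (so `Ψ₀(∞) = ∞`). -/
def psi0E (t : ℝ≥0∞) : ℝ≥0∞ := t / ENNReal.ofReal (Real.log (Real.exp 1 + t.toReal))

/-- The Poisson kernel `P_r(θ) = (1-r²)/(2π(1 - 2r cos θ + r²))`. -/
def poisson (r θ : ℝ) : ℝ := (1 - r ^ 2) / (2 * π * (1 - 2 * r * Real.cos θ + r ^ 2))

/-- Distance on the torus `ℝ/2πℤ`. -/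
def distT (a b : ℝ) : ℝ := ⨅ n : ℤ, |a - b + 2 * π * n|

/-- The nontangential maximal function
`f*(θ) = sup{ |(P_r ∗ f)(φ)| : 0 < r < 1, dist_𝕋(φ,θ) < 1 - r }`, valued in `[0,∞]`. -/
def nonTanMax (f : ℝ → ℝ) (θ : ℝ) : ℝ≥0∞ :=
  ⨆ (r : ℝ) (φ : ℝ) (_ : 0 < r) (_ : r < 1) (_ : distT φ θ < 1 - r),
    ENNReal.ofReal |∫ t in (0 : ℝ)..(2 * π), poisson r (φ - t) * f t|

/-- The truncated primitive `∫_{a < l < t} v(l) dl`, for `t ∈ [0,∞]`. -/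
def primE (v : ℝ → ℝ) (a : ℝ) (t : ℝ≥0∞) : ℝ≥0∞ :=
  ∫⁻ l in Ioi a, {l : ℝ | ENNReal.ofReal l < t}.indicator (fun l => ENNReal.ofReal (v l)) l

/-- The derivative of `t / log t`. -/
def psiDeriv (l : ℝ) : ℝ := 1 / Real.log l - 1 / Real.log l ^ 2

lemma measurable_psiDeriv : Measurable psiDeriv := by
  unfold psiDeriv; fun_prop

lemma primE_mono (v : ℝ → ℝ) (a : ℝ) : Monotone (primE v a) := by
  intro s t hst
  refine lintegral_mono fun l => indicator_le_indicator_of_subset ?_ (fun _ => zero_le) l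
  exact fun l hl => lt_of_lt_of_le hl hst

lemma primE_ofReal (v : ℝ → ℝ) {a : ℝ} (ha : 0 ≤ a) (t : ℝ) :
    primE v a (ENNReal.ofReal t) = ∫⁻ l in Ioo a t, ENNReal.ofReal (v l) := by
  have hm : MeasurableSet {l : ℝ | ENNReal.ofReal l < ENNReal.ofReal t} :=
    measurableSet_lt (by fun_prop) (by fun_prop)
  unfold primE
  rw [lintegral_indicator hm, Measure.restrict_restrict hm]
  congr 2
  ext l
  simp only [mem_inter_iff, mem_ofPred_eq, mem_Ioi, mem_Ioo]
  constructor
  · rintro ⟨h1, h2⟩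
    exact ⟨h2, (ENNReal.ofReal_lt_ofReal_iff_of_nonneg (ha.trans h2.le)).1 h1⟩
  · rintro ⟨h1, h2⟩
    exact ⟨(ENNReal.ofReal_lt_ofReal_iff_of_nonneg (ha.trans h1.le)).2 h2, h1⟩

lemma primE_eq_sub {V v : ℝ → ℝ} {a t : ℝ} (ha : 0 ≤ a) (hat : a ≤ t)
    (hV : ∀ l ∈ Icc a t, HasDerivAt V (v l) l) (hv : ∀ l ∈ Icc a t, 0 ≤ v l)
    (hc : ContinuousOn v (Icc a t)) :
    primE v a (ENNReal.ofReal t) = ENNReal.ofReal (V t - V a) := by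
  have hi : IntervalIntegrable v volume a t :=
    ContinuousOn.intervalIntegrable (by rwa [uIcc_of_le hat])
  rw [primE_ofReal v ha, restrict_Ioo_eq_restrict_Ioc,
    ← intervalIntegral.integral_eq_sub_of_hasDerivAt (by rwa [uIcc_of_le hat]) hi,
    intervalIntegral.integral_of_le hat, ofReal_integral_eq_lintegral_ofReal]
  · exact (intervalIntegrable_iff_integrableOn_Ioc_of_le hat).1 hi
  · filter_upwards [ae_restrict_mem measurableSet_Ioc] with l hl
    exact hv l ⟨hl.1.le, hl.2⟩

lemma two_le_log {l : ℝ} (hl : Real.exp 2 ≤ l) : 2 ≤ Real.log l :=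
  (Real.le_log_iff_exp_le ((Real.exp_pos 2).trans_le hl)).2 hl

lemma psiDeriv_le {l : ℝ} : psiDeriv l ≤ 1 / Real.log l := by
  unfold psiDeriv
  have : 0 ≤ 1 / Real.log l ^ 2 := by positivity
  linarith

lemma half_le_psiDeriv {l : ℝ} (hl : Real.exp 2 ≤ l) : 1 / 2 * (1 / Real.log l) ≤ psiDeriv l := by
  unfold psiDeriv
  have h2 := two_le_log hl
  have h0 : 0 < Real.log l := by linarith
  have : 1 / Real.log l ^ 2 ≤ 1 / 2 * (1 / Real.log l) := by
    rw [div_mul_div_comm, div_le_div_iff₀ (by positivity) (by positivity)]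
    nlinarith
  linarith

lemma psiDeriv_nonneg {l : ℝ} (hl : Real.exp 2 ≤ l) : 0 ≤ psiDeriv l := by
  have h2 := two_le_log hl
  exact le_trans (by positivity) (half_le_psiDeriv hl)

lemma primE_psiDeriv {a t : ℝ} (ha : Real.exp 2 ≤ a) (hat : a ≤ t) :
    primE psiDeriv a (ENNReal.ofReal t) =
      ENNReal.ofReal (t / Real.log t - a / Real.log a) := by
  have hpos : ∀ l ∈ Icc a t, 0 < l := fun l hl => (Real.exp_pos 2).trans_le (ha.trans hl.1)
  have hlog : ∀ l ∈ Icc a t, Real.log l ≠ 0 := fun l hl => by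
    have := two_le_log (ha.trans hl.1)
    linarith
  refine primE_eq_sub (V := fun l => l / Real.log l) ((Real.exp_pos 2).le.trans ha) hat ?_
    (fun l hl => psiDeriv_nonneg (ha.trans hl.1)) ?_
  · intro l hl
    have h := (hasDerivAt_id l).div (Real.hasDerivAt_log (hpos l hl).ne') (hlog l hl)
    convert! h using 1
    have := hpos l hl
    have := hlog l hl
    simp only [psiDeriv, id]
    field_simp
  · have hlc : ContinuousOn Real.log (Icc a t) :=
      Real.continuousOn_log.mono fun l hl => (hpos l hl).ne'
    exact (continuousOn_const.div hlc hlog).sub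
      (continuousOn_const.div (hlc.pow 2) fun l hl => pow_ne_zero 2 (hlog l hl))

lemma hasDerivAt_log_log {l : ℝ} (hl : Real.exp 2 ≤ l) :
    HasDerivAt (fun l => Real.log (Real.log l)) (1 / Real.log l / l) l := by
  have h2 := two_le_log hl
  have h0 : 0 < l := (Real.exp_pos 2).trans_le hl
  convert! (Real.hasDerivAt_log h0.ne').log (by linarith) using 1
  field_simp

lemma continuousOn_inv_log_div {a t : ℝ} (ha : Real.exp 2 ≤ a) :
    ContinuousOn (fun l => 1 / Real.log l / l) (Icc a t) := by
  have hpos : ∀ l ∈ Icc a t, l ≠ 0 := fun l hl =>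
    ((Real.exp_pos 2).trans_le (ha.trans hl.1)).ne'
  have hlog : ∀ l ∈ Icc a t, Real.log l ≠ 0 := fun l hl => by
    have := two_le_log (ha.trans hl.1)
    linarith
  exact (continuousOn_const.div (Real.continuousOn_log.mono hpos) hlog).div continuousOn_id hpos

lemma primE_inv_log_div {a t : ℝ} (ha : Real.exp 2 ≤ a) (hat : a ≤ t) :
    primE (fun l => 1 / Real.log l / l) a (ENNReal.ofReal t) =
      ENNReal.ofReal (Real.log (Real.log t) - Real.log (Real.log a)) := by
  refine primE_eq_sub ((Real.exp_pos 2).le.trans ha) hat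
    (fun l hl => hasDerivAt_log_log (ha.trans hl.1)) (fun l hl => ?_) (continuousOn_inv_log_div ha)
  have := two_le_log (ha.trans hl.1)
  have := (Real.exp_pos 2).trans_le (ha.trans hl.1)
  positivity

lemma primE_mono_fun {u v : ℝ → ℝ} {a : ℝ} (h : ∀ l, a < l → u l ≤ v l) (t : ℝ≥0∞) :
    primE u a t ≤ primE v a t := by
  refine setLIntegral_mono' measurableSet_Ioi fun l hl => indicator_le_indicator ?_
  exact ENNReal.ofReal_le_ofReal (h l hl)

lemma primE_of_le {v : ℝ → ℝ} {a t : ℝ} (ha : 0 ≤ a) (hat : t ≤ a) :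
    primE v a (ENNReal.ofReal t) = 0 := by
  rw [primE_ofReal v ha, Ioo_eq_empty (by simpa using hat)]
  simp

lemma primE_psiDeriv_div_le {a : ℝ} (ha : Real.exp 2 ≤ a) (t : ℝ) :
    primE (fun l => psiDeriv l / l) a (ENNReal.ofReal t) ≤
      ENNReal.ofReal (logPlus (logPlus t)) := by
  have ha0 := (Real.exp_pos 2).trans_le ha
  rcases le_total t a with h | h
  · rw [primE_of_le ha0.le h]; exact zero_le
  · refine (primE_mono_fun (fun l hl => ?_) _).trans ((primE_inv_log_div ha h).le.trans ?_)
    · exact div_le_div_of_nonneg_right psiDeriv_le (ha0.trans hl).le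
    · refine ENNReal.ofReal_le_ofReal ?_
      have h2 := two_le_log (ha.trans h)
      have h3 : 0 ≤ Real.log (Real.log a) := Real.log_nonneg (by linarith [two_le_log ha])
      have : logPlus t = Real.log t := max_eq_left (by linarith)
      rw [this]
      exact le_trans (by linarith) (le_max_left _ _)

lemma logPlus_mono {s t : ℝ} (hs : 0 ≤ s) (h : s ≤ t) : logPlus s ≤ logPlus t := by
  have := Real.posLog_le_posLog hs h
  simpa only [logPlus, Real.posLog_apply, max_comm] using this

lemma logPlus_nonneg (s : ℝ) : 0 ≤ logPlus s := le_max_right _ _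

lemma logPlus_logPlus_le {a : ℝ} (ha : Real.exp 2 ≤ a) {t : ℝ} (ht : 0 ≤ t) :
    ENNReal.ofReal (logPlus (logPlus t)) ≤ ENNReal.ofReal (logPlus (logPlus a)) +
      2 * primE (fun l => psiDeriv l / l) a (ENNReal.ofReal t) := by
  have ha0 := (Real.exp_pos 2).trans_le ha
  rcases le_total t a with h | h
  · refine le_add_right (ENNReal.ofReal_le_ofReal ?_)
    exact logPlus_mono (logPlus_nonneg _) (logPlus_mono ht h)
  · have e : ∀ s, a ≤ s → logPlus (logPlus s) = Real.log (Real.log s) := fun s hs => by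
      have h2 := two_le_log (ha.trans hs)
      have : logPlus s = Real.log s := max_eq_left (by linarith)
      rw [this]
      exact max_eq_left (Real.log_nonneg (by linarith))
    have h1 : primE (fun l => 1 / Real.log l / l) a (ENNReal.ofReal t) ≤
        2 * primE (fun l => psiDeriv l / l) a (ENNReal.ofReal t) := by
      rw [primE_ofReal _ ha0.le, primE_ofReal _ ha0.le,
        ← lintegral_const_mul' _ _ ENNReal.ofNat_ne_top]
      refine setLIntegral_mono' measurableSet_Ioo fun l hl => ?_
      rw [← ENNReal.ofReal_ofNat, ← ENNReal.ofReal_mul (by norm_num)]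
      refine ENNReal.ofReal_le_ofReal ?_
      rw [← mul_div_assoc]
      refine div_le_div_of_nonneg_right ?_ (ha0.trans hl.1).le
      linarith [half_le_psiDeriv (ha.trans hl.1.le)]
    rw [e t h, e a le_rfl]
    refine le_trans ?_ (add_le_add le_rfl h1)
    rw [primE_inv_log_div ha h]
    refine le_trans (ENNReal.ofReal_le_ofReal (le_of_eq ?_)) ENNReal.ofReal_add_le
    ring

lemma primE_psiDeriv_top {a : ℝ} (ha : Real.exp 2 ≤ a) : primE psiDeriv a ⊤ = ⊤ := by
  have ha0 := (Real.exp_pos 2).trans_le ha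
  have h1 : ∀ t : ℝ, a ≤ t → primE psiDeriv a (ENNReal.ofReal t) ≤ primE psiDeriv a ⊤ :=
    fun t _ => primE_mono _ _ le_top
  have hlim : Filter.Tendsto (fun t : ℝ => t / Real.log t - a / Real.log a)
      Filter.atTop Filter.atTop := by
    refine Filter.tendsto_atTop_add_const_right _ _ ?_
    have h := Real.isLittleO_log_id_atTop.tendsto_div_nhds_zero
    have h' : Filter.Tendsto (fun x : ℝ => Real.log x / x) Filter.atTop (nhdsWithin 0 (Ioi 0)) := by
      refine tendsto_nhdsWithin_iff.2 ⟨h, ?_⟩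
      filter_upwards [Filter.eventually_ge_atTop a] with x hx
      have := two_le_log (ha.trans hx)
      have := ha0.trans_le hx
      simp only [mem_Ioi]
      positivity
    refine h'.inv_tendsto_nhdsGT_zero.congr fun x => ?_
    simp
  have h2 := ENNReal.tendsto_ofReal_atTop.comp hlim
  refine top_le_iff.1 (le_of_tendsto h2 ?_)
  filter_upwards [Filter.eventually_ge_atTop a] with t ht
  exact (primE_psiDeriv ha ht).symm.le.trans (h1 t ht)

lemma psi0E_ofReal {t : ℝ} (ht : 0 ≤ t) :
    psi0E (ENNReal.ofReal t) = ENNReal.ofReal (t / Real.log (Real.exp 1 + t)) := by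
  unfold psi0E
  rw [ENNReal.toReal_ofReal ht, ENNReal.ofReal_div_of_pos]
  refine Real.log_pos ?_
  have := Real.add_one_le_exp 1
  linarith

lemma psi0E_le_add_primE (t : ℝ≥0∞) :
    psi0E t ≤ ENNReal.ofReal (Real.exp 2) + primE psiDeriv (Real.exp 2) t := by
  induction t with
  | top => rw [primE_psiDeriv_top le_rfl]; simp
  | coe t =>
    obtain ⟨s, hs, hst⟩ : ∃ s : ℝ, 0 ≤ s ∧ ENNReal.ofReal s = t := ⟨t, t.2, by simp⟩
    rw [← hst]
    rw [psi0E_ofReal hs]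
    have he := Real.add_one_le_exp 1
    rcases le_total s (Real.exp 2) with h | h
    · refine le_add_right (ENNReal.ofReal_le_ofReal ?_)
      refine (div_le_self hs ?_).trans h
      rw [Real.le_log_iff_exp_le (by linarith)]
      linarith
    · rw [primE_psiDeriv le_rfl h]
      refine le_trans (ENNReal.ofReal_le_ofReal ?_) ENNReal.ofReal_add_le
      have h2 := two_le_log h
      have h3 : s / Real.log (Real.exp 1 + s) ≤ s / Real.log s :=
        div_le_div_of_nonneg_left hs (by linarith)
          (Real.log_le_log ((Real.exp_pos 2).trans_le h) (by linarith))
      have h4 := Real.exp_pos 2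
      rw [Real.log_exp]
      linarith

lemma primE_psiDeriv_le {a : ℝ} (ha : Real.exp 2 ≤ a) (t : ℝ≥0∞) :
    primE psiDeriv a t ≤ 2 * psi0E t := by
  have ha0 := (Real.exp_pos 2).trans_le ha
  induction t with
  | top => simp [psi0E]
  | coe t =>
    obtain ⟨s, hs, hst⟩ : ∃ s : ℝ, 0 ≤ s ∧ ENNReal.ofReal s = t := ⟨t, t.2, by simp⟩
    rw [← hst]
    rw [psi0E_ofReal hs]
    rcases le_total s a with h | h
    · rw [primE_of_le ha0.le h]; exact zero_le
    · rw [primE_psiDeriv ha h, ← ENNReal.ofReal_ofNat, ← ENNReal.ofReal_mul (by norm_num)]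
      refine ENNReal.ofReal_le_ofReal ?_
      have h2 := two_le_log (ha.trans h)
      have h3 := two_le_log ha
      have he2 := Real.add_one_le_exp 2
      have h1 : Real.exp 1 ≤ s := (Real.exp_le_exp.2 (by norm_num)).trans (ha.trans h)
      have hs3 : 3 ≤ s := by linarith
      have h4 : Real.log (Real.exp 1 + s) ≤ 2 * Real.log s := by
        rw [← Real.log_rpow (by linarith)]
        refine Real.log_le_log (by positivity) ?_
        rw [Real.rpow_two]
        nlinarith
      have h5 : 0 < Real.log (Real.exp 1 + s) := Real.log_pos (by linarith [Real.exp_pos 1])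
      have h6 : s / Real.log s ≤ 2 * (s / Real.log (Real.exp 1 + s)) := by
        rw [← mul_div_assoc, div_le_div_iff₀ (by linarith) h5]
        nlinarith
      have h7 : 0 ≤ a / Real.log a := by positivity
      linarith

lemma logPlus_logPlus_mul_le (A s : ℝ) :
    logPlus (logPlus (A * s)) ≤
      Real.log 2 + logPlus (logPlus A) + logPlus (logPlus s) := by
  have h1 : logPlus (A * s) ≤ logPlus A + logPlus s := by
    simpa only [logPlus, Real.posLog_apply, max_comm] using Real.posLog_mul (x := A) (y := s)
  have h2 : logPlus (logPlus A + logPlus s) ≤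
      Real.log 2 + logPlus (logPlus A) + logPlus (logPlus s) := by
    simpa only [logPlus, Real.posLog_apply, max_comm] using
      Real.posLog_add (x := logPlus A) (y := logPlus s)
  exact (logPlus_mono (logPlus_nonneg _) h1).trans h2

/-- The uncentered Hardy–Littlewood maximal function over intervals with rational endpoints. -/
def hlMax (g : ℝ → ℝ≥0∞) (x : ℝ) : ℝ≥0∞ :=
  ⨆ I : ℚ × ℚ, (Ioo (I.1 : ℝ) I.2).indicator
    (fun _ => (∫⁻ y in Ioo (I.1 : ℝ) I.2, g y) / ENNReal.ofReal (I.2 - I.1)) x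

lemma measurable_hlMax (g : ℝ → ℝ≥0∞) : Measurable (hlMax g) :=
  Measurable.iSup fun _ => measurable_const.indicator measurableSet_Ioo

lemma setLIntegral_large_part {g : ℝ → ℝ≥0∞} (hg : Measurable g) {l p q : ℝ}
    (h : ENNReal.ofReal l * ENNReal.ofReal (q - p) < ∫⁻ y in Ioo p q, g y) :
    ENNReal.ofReal l * ENNReal.ofReal (q - p) ≤
      2 * ∫⁻ y in Ioo p q, {x | ENNReal.ofReal l < 2 * g x}.indicator g y := by
  have hm : MeasurableSet {x | ENNReal.ofReal l < 2 * g x} :=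
    measurableSet_lt measurable_const (hg.const_mul 2)
  set A := ENNReal.ofReal l * ENNReal.ofReal (q - p)
  have hA : A ≠ ⊤ := ENNReal.mul_ne_top ENNReal.ofReal_ne_top ENNReal.ofReal_ne_top
  have h1 : 2 * ∫⁻ y in Ioo p q, g y ≤
      A + 2 * ∫⁻ y in Ioo p q, {x | ENNReal.ofReal l < 2 * g x}.indicator g y := by
    rw [← lintegral_const_mul _ hg, ← lintegral_const_mul _ (hg.indicator hm)]
    have : A = ∫⁻ y in Ioo p q, ENNReal.ofReal l := by simp [A]
    rw [this, ← lintegral_add_left measurable_const]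
    refine lintegral_mono fun y => ?_
    by_cases hy : ENNReal.ofReal l < 2 * g y
    · rw [indicator_of_mem (by exact hy)]
      exact le_add_self
    · rw [indicator_of_notMem (by exact hy)]
      simpa using hy
  have h2 : A + A ≤ A + 2 * ∫⁻ y in Ioo p q, {x | ENNReal.ofReal l < 2 * g x}.indicator g y := by
    refine le_trans ?_ h1
    rw [← two_mul]
    gcongr
  exact (ENNReal.add_le_add_iff_left hA).1 h2

/-- The weak type `(1,1)` inequality for the part of `g` above half the level. -/
lemma hlMax_weak_type {g : ℝ → ℝ≥0∞} (hg : Measurable g) (hfin : ∫⁻ x, g x ≠ ⊤) {l : ℝ}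
    (hl : 0 < l) :
    ENNReal.ofReal l * volume {x | ENNReal.ofReal l < hlMax g x} ≤
      10 * ∫⁻ x, {x | ENNReal.ofReal l < 2 * g x}.indicator g x := by
  have hl' : ENNReal.ofReal l ≠ 0 := by simpa using hl
  set T : Set (ℚ × ℚ) := {I | (I.1 : ℝ) < I.2 ∧
    ENNReal.ofReal l * ENNReal.ofReal (I.2 - I.1) < ∫⁻ y in Ioo (I.1 : ℝ) I.2, g y} with hT
  have hball : ∀ I : ℚ × ℚ, Ioo (I.1 : ℝ) I.2 =
      Metric.ball (((I.1 : ℝ) + I.2) / 2) (((I.2 : ℝ) - I.1) / 2) := fun I => Real.Ioo_eq_ball _ _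
  obtain ⟨u, huT, hud, hu⟩ := Vitali.exists_disjoint_subfamily_covering_enlargement_ball T
    (fun I => ((I.1 : ℝ) + I.2) / 2) (fun I => ((I.2 : ℝ) - I.1) / 2)
    ((∫⁻ x, g x).toReal / l) (fun I hI => by
      have h1 := hI.2.le.trans (setLIntegral_le_lintegral _ _)
      rw [← ENNReal.ofReal_mul hl.le, ENNReal.ofReal_le_iff_le_toReal hfin] at h1
      rw [le_div_iff₀ hl]
      have := mul_pos hl (sub_pos.2 hI.1)
      linarith) 5 (by norm_num)
  simp only [← hball] at hud hu
  have hsub : {x | ENNReal.ofReal l < hlMax g x} ⊆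
      ⋃ I : u, Metric.ball ((((I : ℚ × ℚ).1 : ℝ) + (I : ℚ × ℚ).2) / 2)
        (5 * ((((I : ℚ × ℚ).2 : ℝ) - (I : ℚ × ℚ).1) / 2)) := by
    intro x hx
    obtain ⟨I, hI⟩ := lt_iSup_iff.1 (show ENNReal.ofReal l < hlMax g x from hx)
    have hxI : x ∈ Ioo (I.1 : ℝ) I.2 := by
      by_contra hcon
      rw [indicator_of_notMem hcon] at hI
      simp at hI
    have hpq : (I.1 : ℝ) < I.2 := hxI.1.trans hxI.2
    rw [indicator_of_mem hxI, ENNReal.lt_div_iff_mul_lt (by simp) (by simp)] at hI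
    obtain ⟨b, hb, hb'⟩ := hu I ⟨hpq, hI⟩
    exact mem_iUnion.2 ⟨⟨b, hb⟩, hb' hxI⟩
  have hd : Pairwise (Function.onFun Disjoint
      fun I : u => Ioo ((I : ℚ × ℚ).1 : ℝ) (I : ℚ × ℚ).2) := by
    intro I J hIJ
    exact hud I.2 J.2 (fun h => hIJ (Subtype.ext h))
  calc ENNReal.ofReal l * volume {x | ENNReal.ofReal l < hlMax g x}
      ≤ ENNReal.ofReal l * ∑' I : u, 5 * ENNReal.ofReal
          (((I : ℚ × ℚ).2 : ℝ) - (I : ℚ × ℚ).1) := by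
        gcongr
        refine (measure_mono hsub).trans ((measure_iUnion_le _).trans ?_)
        refine ENNReal.tsum_le_tsum fun I => ?_
        rw [Real.volume_ball, ← ENNReal.ofReal_ofNat, ← ENNReal.ofReal_mul (by norm_num)]
        refine ENNReal.ofReal_le_ofReal (le_of_eq ?_)
        ring
    _ = 5 * ∑' I : u, ENNReal.ofReal l * ENNReal.ofReal
          (((I : ℚ × ℚ).2 : ℝ) - (I : ℚ × ℚ).1) := by
        rw [ENNReal.tsum_mul_left, ENNReal.tsum_mul_left]; ring
    _ ≤ 5 * ∑' I : u, 2 * ∫⁻ y in Ioo ((I : ℚ × ℚ).1 : ℝ) (I : ℚ × ℚ).2,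
          {x | ENNReal.ofReal l < 2 * g x}.indicator g y := by
        exact mul_le_mul' le_rfl
          (ENNReal.tsum_le_tsum fun I => setLIntegral_large_part hg (huT I.2).2)
    _ = 10 * ∫⁻ y in ⋃ I : u, Ioo ((I : ℚ × ℚ).1 : ℝ) (I : ℚ × ℚ).2,
          {x | ENNReal.ofReal l < 2 * g x}.indicator g y := by
        rw [ENNReal.tsum_mul_left, lintegral_iUnion (fun _ => measurableSet_Ioo) hd, ← mul_assoc]
        norm_num
    _ ≤ _ := by
        gcongr
        exact Measure.restrict_le_self

/-- Tonelli's theorem for compositions with `primE`. -/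
lemma lintegral_mul_primE {v : ℝ → ℝ} (hv : Measurable v) (a : ℝ) {g M : ℝ → ℝ≥0∞}
    (hg : Measurable g) (hM : Measurable M) :
    ∫⁻ x, g x * primE v a (M x) =
      ∫⁻ l in Ioi a, ENNReal.ofReal (v l) * ∫⁻ x, {x | ENNReal.ofReal l < M x}.indicator g x := by
  have hs : MeasurableSet {z : ℝ × ℝ | ENNReal.ofReal z.2 < M z.1} :=
    measurableSet_lt (by fun_prop) (by fun_prop)
  have hF : Measurable (fun z : ℝ × ℝ => {z : ℝ × ℝ | ENNReal.ofReal z.2 < M z.1}.indicator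
      (fun z => g z.1 * ENNReal.ofReal (v z.2)) z) :=
    Measurable.indicator (by fun_prop) hs
  have h := lintegral_lintegral_swap (μ := volume) (ν := volume.restrict (Ioi a))
    (f := fun x l => {z : ℝ × ℝ | ENNReal.ofReal z.2 < M z.1}.indicator
      (fun z => g z.1 * ENNReal.ofReal (v z.2)) (x, l)) hF.aemeasurable
  have e1 : ∀ x, g x * primE v a (M x) = ∫⁻ l in Ioi a,
      {z : ℝ × ℝ | ENNReal.ofReal z.2 < M z.1}.indicator
      (fun z => g z.1 * ENNReal.ofReal (v z.2)) (x, l) := fun x => by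
    have hm : MeasurableSet {l : ℝ | ENNReal.ofReal l < M x} :=
      measurableSet_lt (by fun_prop) (by fun_prop)
    unfold primE
    rw [← lintegral_const_mul _ (Measurable.indicator (by fun_prop) hm)]
    refine lintegral_congr fun l => ?_
    by_cases hl : ENNReal.ofReal l < M x <;> simp [indicator, hl]
  have e2 : ∀ l, ENNReal.ofReal (v l) * ∫⁻ x, {x | ENNReal.ofReal l < M x}.indicator g x =
      ∫⁻ x, {z : ℝ × ℝ | ENNReal.ofReal z.2 < M z.1}.indicator
      (fun z => g z.1 * ENNReal.ofReal (v z.2)) (x, l) := fun l => by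
    have hm : MeasurableSet {x : ℝ | ENNReal.ofReal l < M x} :=
      measurableSet_lt (by fun_prop) (by fun_prop)
    rw [← lintegral_const_mul _ (hg.indicator hm)]
    refine lintegral_congr fun x => ?_
    by_cases hl : ENNReal.ofReal l < M x <;> simp [indicator, hl, mul_comm]
  simp only [e1, e2]
  exact h

lemma lintegral_primE {v : ℝ → ℝ} (hv : Measurable v) (a : ℝ) {M : ℝ → ℝ≥0∞}
    (hM : Measurable M) :
    ∫⁻ x, primE v a (M x) =
      ∫⁻ l in Ioi a, ENNReal.ofReal (v l) * volume {x | ENNReal.ofReal l < M x} := by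
  have h := lintegral_mul_primE hv a (g := fun _ => 1) measurable_const hM
  simp only [one_mul] at h
  rw [h]
  refine lintegral_congr fun l => ?_
  have hm : MeasurableSet {x : ℝ | ENNReal.ofReal l < M x} :=
    measurableSet_lt (by fun_prop) (by fun_prop)
  rw [lintegral_indicator hm]
  simp

lemma ofReal_psiDeriv_eq {l : ℝ} (hl : 0 < l) :
    ENNReal.ofReal (psiDeriv l) = ENNReal.ofReal (psiDeriv l / l) * ENNReal.ofReal l := by
  rw [← ENNReal.ofReal_mul' hl.le, div_mul_cancel₀ _ hl.ne']

lemma lintegral_primE_hlMax_le {g : ℝ → ℝ≥0∞} (hg : Measurable g) (hfin : ∫⁻ x, g x ≠ ⊤)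
    {a : ℝ} (ha : 0 < a) :
    ∫⁻ x, primE psiDeriv a (hlMax g x) ≤
      10 * ∫⁻ x, g x * primE (fun l => psiDeriv l / l) a (2 * g x) := by
  rw [lintegral_primE measurable_psiDeriv a (measurable_hlMax g),
    lintegral_mul_primE (v := fun l => psiDeriv l / l)
      (measurable_psiDeriv.div measurable_id) a hg (hg.const_mul 2),
    ← lintegral_const_mul' _ _ ENNReal.ofNat_ne_top]
  refine setLIntegral_mono' measurableSet_Ioi fun l hl => ?_
  have hl0 : 0 < l := ha.trans hl
  rw [ofReal_psiDeriv_eq hl0, mul_assoc, mul_left_comm 10]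
  exact mul_le_mul' le_rfl (hlMax_weak_type hg hfin hl0)

lemma hlMax_const_mul {c : ℝ≥0∞} (hc : c ≠ ⊤) (g : ℝ → ℝ≥0∞) (x : ℝ) :
    hlMax (fun y => c * g y) x = c * hlMax g x := by
  unfold hlMax
  rw [ENNReal.mul_iSup]
  refine iSup_congr fun I => ?_
  by_cases hx : x ∈ Ioo (I.1 : ℝ) I.2
  · rw [indicator_of_mem hx, indicator_of_mem hx, lintegral_const_mul' _ _ hc, mul_div_assoc]
  · rw [indicator_of_notMem hx, indicator_of_notMem hx, mul_zero]

lemma setLIntegral_le_hlMax (g : ℝ → ℝ≥0∞) (x : ℝ) {ρ : ℝ} (hρ : 0 < ρ) :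
    ∫⁻ y in Ioo (x - ρ) (x + ρ), g y ≤ ENNReal.ofReal (4 * ρ) * hlMax g x := by
  obtain ⟨p, hp1, hp2⟩ := exists_rat_btwn (show x - 2 * ρ < x - ρ by linarith)
  obtain ⟨q, hq1, hq2⟩ := exists_rat_btwn (show x + ρ < x + 2 * ρ by linarith)
  have h1 : (∫⁻ y in Ioo (p : ℝ) q, g y) / ENNReal.ofReal (q - p) ≤ hlMax g x := by
    refine le_trans ?_ (le_iSup _ (p, q))
    rw [indicator_of_mem (show x ∈ Ioo (p : ℝ) q from ⟨by linarith, by linarith⟩)]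
  have hpq : (p : ℝ) < q := by linarith
  rw [ENNReal.div_le_iff_le_mul (Or.inl (by simpa using hpq)) (Or.inl ENNReal.ofReal_ne_top)] at h1
  calc ∫⁻ y in Ioo (x - ρ) (x + ρ), g y ≤ ∫⁻ y in Ioo (p : ℝ) q, g y :=
        lintegral_mono_set (Ioo_subset_Ioo hp2.le hq1.le)
    _ ≤ hlMax g x * ENNReal.ofReal (q - p) := h1
    _ ≤ ENNReal.ofReal (4 * ρ) * hlMax g x := by
        rw [mul_comm]
        gcongr
        linarith

lemma poisson_denom_eq (r v : ℝ) :
    1 - 2 * r * Real.cos v + r ^ 2 = (1 - r) ^ 2 + 4 * r * Real.sin (v / 2) ^ 2 := by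
  have h : Real.cos v = 1 - 2 * Real.sin (v / 2) ^ 2 := by
    rw [← Real.cos_sq_add_sin_sq (v / 2)]
    have := Real.cos_two_mul' (v / 2)
    rw [mul_div_cancel₀ _ two_ne_zero] at this
    rw [this]; ring
  rw [h]; ring

lemma poisson_nonneg {r : ℝ} (h0 : 0 < r) (h1 : r < 1) (v : ℝ) : 0 ≤ poisson r v := by
  unfold poisson
  rw [poisson_denom_eq]
  have : 0 ≤ 1 - r ^ 2 := by nlinarith
  positivity

lemma poisson_le_div_denom {r : ℝ} (h0 : 0 < r) (h1 : r < 1) (v : ℝ) :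
    poisson r v ≤ (1 - r) / ((1 - r) ^ 2 + 4 * r * Real.sin (v / 2) ^ 2) := by
  unfold poisson
  rw [poisson_denom_eq]
  have hd : 0 < (1 - r) ^ 2 + 4 * r * Real.sin (v / 2) ^ 2 := by
    have : 0 < (1 - r) ^ 2 := pow_pos (by linarith) 2
    positivity
  rw [← div_div]
  refine div_le_div_of_nonneg_right ?_ hd.le
  rw [div_le_iff₀ (by positivity)]
  nlinarith [Real.pi_gt_three]

lemma sq_le_poisson_denom {r v : ℝ} (h0 : 0 < r) (hv : |v| ≤ π) :
    v ^ 2 / (2 * π ^ 2) ≤ (1 - r) ^ 2 + 4 * r * Real.sin (v / 2) ^ 2 := by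
  have h2 : |v / 2| = |v| / 2 := by rw [abs_div, abs_two]
  have h := Real.mul_abs_le_abs_sin (x := v / 2) (by rw [h2]; linarith)
  have hs : Real.sin (v / 2) ^ 2 ≤ 1 := Real.sin_sq_le_one _
  have h3 : v ^ 2 / π ^ 2 ≤ Real.sin (v / 2) ^ 2 := by
    have : (2 / π * |v / 2|) ^ 2 ≤ |Real.sin (v / 2)| ^ 2 := by gcongr
    rw [sq_abs, h2, mul_pow, div_pow, div_pow, sq_abs] at this
    refine le_trans (le_of_eq ?_) this
    field_simp
  have h4 : v ^ 2 / (2 * π ^ 2) = v ^ 2 / π ^ 2 / 2 := by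
    field_simp
  rw [h4]
  have hs0 := sq_nonneg (Real.sin (v / 2))
  rcases le_total (1 / 8) r with hr | hr <;> nlinarith [sq_nonneg (1 - r)]

lemma exists_poisson_le {r v : ℝ} (h0 : 0 < r) (h1 : r < 1) (hv : |v| ≤ π) :
    ∃ k : ℕ, |v| < 2 ^ k * (1 - r) ∧ poisson r v ≤ 8 * π ^ 2 / (4 ^ k * (1 - r)) := by
  have hδ : 0 < 1 - r := by linarith
  have hP := poisson_le_div_denom h0 h1 v
  have hex : ∃ k : ℕ, |v| < 2 ^ k * (1 - r) := by
    obtain ⟨k, hk⟩ := pow_unbounded_of_one_lt (|v| / (1 - r)) (one_lt_two : (1 : ℝ) < 2)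
    exact ⟨k, (div_lt_iff₀ hδ).1 hk⟩
  classical
  refine ⟨Nat.find hex, Nat.find_spec hex, hP.trans ?_⟩
  have hpi := Real.pi_gt_three
  rcases hk : Nat.find hex with _ | k
  · rw [div_le_div_iff₀ (by positivity) (by positivity)]
    have : 0 ≤ 4 * r * Real.sin (v / 2) ^ 2 := by positivity
    have h8 : 1 ≤ 8 * π ^ 2 := by nlinarith
    rw [pow_zero, one_mul, ← sq]
    refine le_trans ?_ (le_mul_of_one_le_left (by positivity) h8)
    linarith
  · have hlt : 2 ^ k * (1 - r) ≤ |v| := not_lt.1 (Nat.find_min hex (m := k) (by omega))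
    have hv2 : (2 ^ k * (1 - r)) ^ 2 ≤ v ^ 2 := by
      rw [← sq_abs v]; gcongr
    have hd := sq_le_poisson_denom h0 hv
    have hd2 : (2 ^ k * (1 - r)) ^ 2 / (2 * π ^ 2) ≤
        (1 - r) ^ 2 + 4 * r * Real.sin (v / 2) ^ 2 := le_trans (by gcongr) hd
    refine (div_le_div_of_nonneg_left hδ.le (by positivity) hd2).trans (le_of_eq ?_)
    have h4 : (4 : ℝ) ^ k = 2 ^ k * 2 ^ k := by rw [← mul_pow]; norm_num
    rw [pow_succ 4, h4]
    field_simp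
    ring

lemma exists_near_of_distT_lt {φ θ δ : ℝ} (h : distT φ θ < δ) :
    ∃ n : ℤ, |φ - θ + 2 * π * n| < δ :=
  exists_lt_of_ciInf_lt h

lemma poisson_add_int (r v : ℝ) (n : ℤ) : poisson r (v + 2 * π * n) = poisson r v := by
  unfold poisson
  rw [show v + 2 * π * n = v + n * (2 * π) by ring, Real.cos_add_int_mul_two_pi]

/-- The dyadic majorant of the Poisson kernel with `1 - r = δ` centered at `x`. -/
def dyadicMajorant (δ x t : ℝ) : ℝ≥0∞ :=
  ∑' k : ℕ, (Ioo (x - 2 ^ (k + 1) * δ) (x + 2 ^ (k + 1) * δ)).indicator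
    (fun _ => ENNReal.ofReal (8 * π ^ 2 / (4 ^ k * δ))) t

lemma poisson_le_dyadicMajorant {r u x t : ℝ} (h0 : 0 < r) (h1 : r < 1) (hu : |u - t| ≤ π)
    (hx : |u - x| < 1 - r) :
    ENNReal.ofReal (poisson r (u - t)) ≤ dyadicMajorant (1 - r) x t := by
  obtain ⟨k, hk, hP⟩ := exists_poisson_le h0 h1 hu
  refine le_trans ?_ (ENNReal.le_tsum k)
  have hδ : 1 - r ≤ 2 ^ k * (1 - r) := le_mul_of_one_le_left (by linarith) (one_le_pow₀ (by norm_num))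
  rw [abs_lt] at hk hx
  rw [indicator_of_mem]
  · exact ENNReal.ofReal_le_ofReal hP
  · rw [pow_succ]
    constructor <;> linarith

lemma lintegral_dyadicMajorant_le {g : ℝ → ℝ≥0∞} (hg : Measurable g) {δ : ℝ} (hδ : 0 < δ)
    (x : ℝ) :
    ∫⁻ t, dyadicMajorant δ x t * g t ≤ ENNReal.ofReal (128 * π ^ 2) * hlMax g x := by
  have hm : ∀ k : ℕ, Measurable ((Ioo (x - 2 ^ (k + 1) * δ) (x + 2 ^ (k + 1) * δ)).indicator
    (fun _ => ENNReal.ofReal (8 * π ^ 2 / (4 ^ k * δ)))) := fun k =>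
    measurable_const.indicator measurableSet_Ioo
  simp only [dyadicMajorant, ← ENNReal.tsum_mul_right]
  rw [lintegral_tsum (f := fun (k : ℕ) t => (Ioo (x - 2 ^ (k + 1) * δ)
    (x + 2 ^ (k + 1) * δ)).indicator (fun _ => ENNReal.ofReal (8 * π ^ 2 / (4 ^ k * δ))) t * g t)
    fun k => ((hm k).mul hg).aemeasurable]
  have hk : ∀ k : ℕ, ∫⁻ t, (Ioo (x - 2 ^ (k + 1) * δ) (x + 2 ^ (k + 1) * δ)).indicator
      (fun _ => ENNReal.ofReal (8 * π ^ 2 / (4 ^ k * δ))) t * g t ≤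
      ENNReal.ofReal (64 * π ^ 2) * hlMax g x * 2⁻¹ ^ k := by
    intro k
    have e : ∀ t, (Ioo (x - 2 ^ (k + 1) * δ) (x + 2 ^ (k + 1) * δ)).indicator
        (fun _ => ENNReal.ofReal (8 * π ^ 2 / (4 ^ k * δ))) t * g t =
        (Ioo (x - 2 ^ (k + 1) * δ) (x + 2 ^ (k + 1) * δ)).indicator
        (fun t => ENNReal.ofReal (8 * π ^ 2 / (4 ^ k * δ)) * g t) t := fun t => by
      by_cases ht : t ∈ Ioo (x - 2 ^ (k + 1) * δ) (x + 2 ^ (k + 1) * δ)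
      · rw [indicator_of_mem ht, indicator_of_mem ht]
      · rw [indicator_of_notMem ht, indicator_of_notMem ht, zero_mul]
    simp only [e]
    rw [lintegral_indicator measurableSet_Ioo, lintegral_const_mul _ hg]
    calc _ ≤ ENNReal.ofReal (8 * π ^ 2 / (4 ^ k * δ)) *
          (ENNReal.ofReal (4 * (2 ^ (k + 1) * δ)) * hlMax g x) := by
          gcongr
          exact setLIntegral_le_hlMax g x (by positivity)
      _ = ENNReal.ofReal (64 * π ^ 2 * (1 / 2) ^ k) * hlMax g x := by
          rw [← mul_assoc, ← ENNReal.ofReal_mul (by positivity)]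
          congr 2
          have h4 : (4 : ℝ) ^ k = 2 ^ k * 2 ^ k := by rw [← mul_pow]; norm_num
          rw [pow_succ, h4, one_div, inv_pow]
          field_simp
          ring
      _ = _ := by
          rw [ENNReal.ofReal_mul (by positivity), ENNReal.ofReal_pow (by norm_num), one_div,
            ENNReal.ofReal_inv_of_pos (by norm_num), ENNReal.ofReal_ofNat]
          ring
  refine (ENNReal.tsum_le_tsum hk).trans (le_of_eq ?_)
  rw [ENNReal.tsum_mul_left, ENNReal.tsum_geometric_two,
    show 128 * π ^ 2 = 64 * π ^ 2 * 2 by ring, ENNReal.ofReal_mul (p := 64 * π ^ 2) (by positivity),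
    ENNReal.ofReal_ofNat]
  ring

lemma measurable_dyadicMajorant (δ x : ℝ) : Measurable (dyadicMajorant δ x) :=
  Measurable.tsum fun _ => measurable_const.indicator measurableSet_Ioo

lemma nonTanMax_le_hlMax {f : ℝ → ℝ} (hf : Measurable f) {θ : ℝ} (hθ : θ ∈ Ico 0 (2 * π)) :
    nonTanMax f θ ≤ ENNReal.ofReal (128 * π ^ 2) *
      (hlMax ((Ico 0 (2 * π)).indicator fun t => ‖f t‖ₑ) θ +
      hlMax ((Ico 0 (2 * π)).indicator fun t => ‖f t‖ₑ) (θ + 2 * π) +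
      hlMax ((Ico 0 (2 * π)).indicator fun t => ‖f t‖ₑ) (θ - 2 * π)) := by
  set g : ℝ → ℝ≥0∞ := (Ico 0 (2 * π)).indicator fun t => ‖f t‖ₑ with hgdef
  have hg : Measurable g := hf.enorm.indicator measurableSet_Ico
  refine iSup_le fun r => iSup_le fun φ => iSup_le fun h0 => iSup_le fun h1 => iSup_le fun hd => ?_
  have hδ : 0 < 1 - r := by linarith
  obtain ⟨n, hn⟩ := exists_near_of_distT_lt hd
  set u := φ + 2 * π * n with hu
  have hun : |u - θ| < 1 - r := by rwa [hu, show φ + 2 * π * n - θ = φ - θ + 2 * π * n by ring]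
  have hker : ∀ t ∈ Ico 0 (2 * π), ENNReal.ofReal (poisson r (φ - t)) ≤
      dyadicMajorant (1 - r) θ t + dyadicMajorant (1 - r) (θ + 2 * π) t +
        dyadicMajorant (1 - r) (θ - 2 * π) t := by
    intro t ht
    have hpi := Real.pi_gt_three
    have hun' := abs_lt.1 hun
    have e : ∀ m : ℤ, poisson r (φ - t) = poisson r (u + 2 * π * m - t) := fun m => by
      rw [show u + 2 * π * m - t = φ - t + 2 * π * ((n + m : ℤ) : ℝ) by
        rw [hu]; push_cast; ring, poisson_add_int]
    rcases le_or_gt (u - t) π with h | h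
    · rcases le_or_gt (-π) (u - t) with h' | h'
      · rw [show poisson r (φ - t) = poisson r (u - t) by simpa using e 0, add_assoc]
        exact le_add_right (poisson_le_dyadicMajorant h0 h1 (abs_le.2 ⟨h', h⟩) hun)
      · rw [e 1]
        refine le_add_right (le_add_left (poisson_le_dyadicMajorant h0 h1 (abs_le.2 ?_) ?_))
        · constructor <;> push_cast <;> linarith [hθ.1, ht.2]
        · rwa [show u + 2 * π * ((1 : ℤ) : ℝ) - (θ + 2 * π) = u - θ by push_cast; ring]
    · rw [e (-1)]
      refine le_add_left (poisson_le_dyadicMajorant h0 h1 (abs_le.2 ?_) ?_)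
      · constructor <;> push_cast <;> linarith [hθ.2, ht.1]
      · rwa [show u + 2 * π * ((-1 : ℤ) : ℝ) - (θ - 2 * π) = u - θ by push_cast; ring]
  rw [← Real.enorm_eq_ofReal_abs, intervalIntegral.integral_of_le (by positivity),
    ← restrict_Ico_eq_restrict_Ioc]
  refine (enorm_integral_le_lintegral_enorm _).trans ?_
  calc ∫⁻ t in Ico 0 (2 * π), ‖poisson r (φ - t) * f t‖ₑ
      ≤ ∫⁻ t in Ico 0 (2 * π), (dyadicMajorant (1 - r) θ t * g t +
          dyadicMajorant (1 - r) (θ + 2 * π) t * g t +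
          dyadicMajorant (1 - r) (θ - 2 * π) t * g t) := by
        refine setLIntegral_mono' measurableSet_Ico fun t ht => ?_
        rw [enorm_mul, Real.enorm_of_nonneg (poisson_nonneg h0 h1 _), hgdef, indicator_of_mem ht,
          ← add_mul, ← add_mul]
        gcongr
        exact hker t ht
    _ ≤ ∫⁻ t, (dyadicMajorant (1 - r) θ t * g t +
          dyadicMajorant (1 - r) (θ + 2 * π) t * g t +
          dyadicMajorant (1 - r) (θ - 2 * π) t * g t) := setLIntegral_le_lintegral _ _
    _ = (∫⁻ t, dyadicMajorant (1 - r) θ t * g t) +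
          (∫⁻ t, dyadicMajorant (1 - r) (θ + 2 * π) t * g t) +
          ∫⁻ t, dyadicMajorant (1 - r) (θ - 2 * π) t * g t := by
        have hm : ∀ x, Measurable fun t => dyadicMajorant (1 - r) x t * g t := fun x =>
          (measurable_dyadicMajorant (1 - r) x).mul hg
        rw [lintegral_add_right _ (hm _), lintegral_add_right _ (hm _)]
    _ ≤ _ := by
        rw [mul_add, mul_add]
        gcongr <;> exact lintegral_dyadicMajorant_le hg hδ _

lemma Monotone.map_add_add_le {F : ℝ≥0∞ → ℝ≥0∞} (hF : Monotone F) (x y z : ℝ≥0∞) :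
    F (x + y + z) ≤ F (3 * x) + F (3 * y) + F (3 * z) := by
  have key : ∀ w, x ≤ w → y ≤ w → z ≤ w → F (x + y + z) ≤ F (3 * w) := fun w h1 h2 h3 =>
    hF ((add_le_add (add_le_add h1 h2) h3).trans (le_of_eq (by ring)))
  rcases le_total x y with h | h
  · rcases le_total y z with h' | h'
    · exact le_add_left (key z (h.trans h') h' le_rfl)
    · exact le_add_right (le_add_left (key y h le_rfl h'))
  · rcases le_total x z with h' | h'
    · exact le_add_left (key z h' (h.trans h') le_rfl)
    · exact le_add_right (le_add_right (key x le_rfl h h'))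

theorem lintegral_psi0E_nonTanMax_lt_top {f : ℝ → ℝ} (hmeas : Measurable f)
    (hf : IntegrableOn f (Ico 0 (2 * π)))
    (hL : ∫⁻ θ in Ico 0 (2 * π), ENNReal.ofReal (|f θ| * logPlus (logPlus |f θ|)) < ⊤) :
    ∫⁻ θ in Ico 0 (2 * π), psi0E (nonTanMax f θ) < ⊤ := by
  set g : ℝ → ℝ≥0∞ := (Ico 0 (2 * π)).indicator fun t => ‖f t‖ₑ with hgdef
  have hg : Measurable g := hmeas.enorm.indicator measurableSet_Ico
  set K : ℝ := 3 * (128 * π ^ 2) with hK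
  have hK0 : 0 ≤ K := by positivity
  set G : ℝ → ℝ≥0∞ := fun x => ENNReal.ofReal K * g x with hG
  have hGm : Measurable G := hg.const_mul _
  have hgfin : ∫⁻ x, g x < ⊤ := by
    rw [hgdef, lintegral_indicator measurableSet_Ico]
    exact hf.2
  have hGfin : ∫⁻ x, G x < ⊤ := by
    rw [hG, lintegral_const_mul _ hg]
    exact ENNReal.mul_lt_top ENNReal.ofReal_lt_top hgfin
  set F := primE psiDeriv (Real.exp 2) with hF
  have hpt : ∀ θ ∈ Ico 0 (2 * π), psi0E (nonTanMax f θ) ≤ ENNReal.ofReal (Real.exp 2) +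
      (F (hlMax G θ) + F (hlMax G (θ + 2 * π)) + F (hlMax G (θ - 2 * π))) := by
    intro θ hθ
    refine (psi0E_le_add_primE _).trans (add_le_add le_rfl ?_)
    refine (primE_mono _ _ (nonTanMax_le_hlMax hmeas hθ)).trans ?_
    rw [mul_add, mul_add]
    refine ((primE_mono _ _).map_add_add_le _ _ _).trans (le_of_eq ?_)
    have e : ∀ x, hlMax G x = 3 * (ENNReal.ofReal (128 * π ^ 2) * hlMax g x) := fun x => by
      rw [hG, hlMax_const_mul ENNReal.ofReal_ne_top, hK, ENNReal.ofReal_mul (by norm_num),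
        ENNReal.ofReal_ofNat, mul_assoc]
    rw [e, e, e]
  have hFm : Measurable fun x => F (hlMax G x) :=
    (primE_mono _ _).measurable.comp (measurable_hlMax G)
  have hmain : ∫⁻ x, F (hlMax G x) < ⊤ := by
    refine (lintegral_primE_hlMax_le hGm hGfin.ne (Real.exp_pos 2)).trans_lt
      (ENNReal.mul_lt_top (by simp) ?_)
    have hC : ∀ x, G x * primE (fun l => psiDeriv l / l) (Real.exp 2) (2 * G x) ≤
        (Ico 0 (2 * π)).indicator (fun x => ENNReal.ofReal K *
          (ENNReal.ofReal (Real.log 2 + logPlus (logPlus (2 * K))) * ‖f x‖ₑ +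
            ENNReal.ofReal (|f x| * logPlus (logPlus |f x|)))) x := by
      intro x
      by_cases hx : x ∈ Ico 0 (2 * π)
      · have e1 : G x = ENNReal.ofReal K * ENNReal.ofReal |f x| := by
          rw [hG, hgdef, ← Real.enorm_eq_ofReal_abs]
          simp only [indicator_of_mem hx]
        have e2 : 2 * G x = ENNReal.ofReal (2 * K * |f x|) := by
          rw [e1, mul_assoc, ENNReal.ofReal_mul (by norm_num : (0 : ℝ) ≤ 2),
            ENNReal.ofReal_mul hK0, ENNReal.ofReal_ofNat]
        rw [indicator_of_mem hx, e2, e1, mul_assoc, Real.enorm_eq_ofReal_abs,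
          ENNReal.ofReal_mul (abs_nonneg _), mul_comm (ENNReal.ofReal (Real.log 2 + _)), ← mul_add]
        gcongr
        refine (primE_psiDeriv_div_le le_rfl _).trans ?_
        exact (ENNReal.ofReal_le_ofReal (logPlus_logPlus_mul_le _ _)).trans ENNReal.ofReal_add_le
      · have : G x = 0 := by simp only [hG, hgdef, indicator_of_notMem hx, mul_zero]
        rw [this, zero_mul]
        exact zero_le
    refine (lintegral_mono hC).trans_lt ?_
    rw [lintegral_indicator measurableSet_Ico, lintegral_const_mul' _ _ ENNReal.ofReal_ne_top,
      lintegral_add_left (hmeas.enorm.const_mul _),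
      lintegral_const_mul' _ _ ENNReal.ofReal_ne_top]
    exact ENNReal.mul_lt_top ENNReal.ofReal_lt_top
      (ENNReal.add_lt_top.2 ⟨ENNReal.mul_lt_top ENNReal.ofReal_lt_top hf.2, hL⟩)
  refine (setLIntegral_mono' measurableSet_Ico hpt).trans_lt ?_
  rw [lintegral_add_left measurable_const]
  refine ENNReal.add_lt_top.2 ⟨by simp [ENNReal.mul_lt_top], ?_⟩
  refine (setLIntegral_le_lintegral _ _).trans_lt ?_
  have hFm' : Measurable fun x => F (hlMax G (x + 2 * π)) := hFm.comp (measurable_add_const _)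
  rw [lintegral_add_left (f := fun x => F (hlMax G x) + F (hlMax G (x + 2 * π))) (hFm.add hFm'),
    lintegral_add_left hFm]
  have e1 : ∫⁻ θ, F (hlMax G (θ + 2 * π)) = ∫⁻ θ, F (hlMax G θ) :=
    lintegral_add_right_eq_self (fun x => F (hlMax G x)) (2 * π)
  have e2 : ∫⁻ θ, F (hlMax G (θ - 2 * π)) = ∫⁻ θ, F (hlMax G θ) :=
    lintegral_sub_right_eq_self (fun x => F (hlMax G x)) (2 * π)
  rw [e1, e2]
  exact ENNReal.add_lt_top.2 ⟨ENNReal.add_lt_top.2 ⟨hmain, hmain⟩, hmain⟩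

/-- The index of the dyadic cell `[2πj/2ⁿ, 2π(j+1)/2ⁿ)` containing `θ`. -/
def cellIdx (n : ℕ) (θ : ℝ) : ℤ := ⌊2 ^ n * (θ / (2 * π))⌋

/-- The dyadic cell of level `n` containing `θ`. -/
def cell (n : ℕ) (θ : ℝ) : Set ℝ := cellIdx n ⁻¹' {cellIdx n θ}

/-- The average of `g` over the dyadic cell of level `n`. -/
def dyAvg (g : ℝ → ℝ≥0∞) (n : ℕ) (θ : ℝ) : ℝ≥0∞ :=
  (∫⁻ t in cell n θ, g t) / ENNReal.ofReal (2 * π / 2 ^ n)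

/-- The dyadic maximal function. -/
def dyMax (g : ℝ → ℝ≥0∞) (θ : ℝ) : ℝ≥0∞ := ⨆ n, dyAvg g n θ

lemma measurable_cellIdx (n : ℕ) : Measurable (cellIdx n) := by
  unfold cellIdx; fun_prop

lemma measurableSet_cell (n : ℕ) (θ : ℝ) : MeasurableSet (cell n θ) :=
  measurable_cellIdx n (measurableSet_singleton _)

lemma mem_cell_self (n : ℕ) (θ : ℝ) : θ ∈ cell n θ := rfl

lemma cell_eq_Ico (n : ℕ) (θ : ℝ) :
    cell n θ = Ico (2 * π / 2 ^ n * cellIdx n θ) (2 * π / 2 ^ n * (cellIdx n θ + 1)) := by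
  ext t
  change ⌊2 ^ n * (t / (2 * π))⌋ = cellIdx n θ ↔ _
  have hp : 0 < 2 * π / 2 ^ n := by positivity
  have e : 2 ^ n * (t / (2 * π)) = t / (2 * π / 2 ^ n) := by field_simp
  rw [Int.floor_eq_iff, mem_Ico, e, le_div_iff₀ hp, div_lt_iff₀ hp, mul_comm, mul_comm _ (2 * π / 2 ^ n)]

lemma volume_cell (n : ℕ) (θ : ℝ) : volume (cell n θ) = ENNReal.ofReal (2 * π / 2 ^ n) := by
  rw [cell_eq_Ico, Real.volume_Ico]
  congr 1
  ring

lemma ofReal_cell_length_ne_zero (n : ℕ) : ENNReal.ofReal (2 * π / 2 ^ n) ≠ 0 := by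
  have : 0 < 2 * π / 2 ^ n := by positivity
  simpa using this

lemma abs_sub_le_of_mem_cell {n : ℕ} {θ t : ℝ} (ht : t ∈ cell n θ) :
    |θ - t| ≤ 2 * π / 2 ^ n := by
  have h := mem_cell_self n θ
  rw [cell_eq_Ico] at h ht
  have e : 2 * π / 2 ^ n * (cellIdx n θ + 1) =
    2 * π / 2 ^ n * cellIdx n θ + 2 * π / 2 ^ n := by ring
  rw [abs_le]
  constructor <;> linarith [h.1, h.2, ht.1, ht.2]

lemma cellIdx_eq_succ_div (n : ℕ) (θ : ℝ) : cellIdx n θ = cellIdx (n + 1) θ / 2 := by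
  unfold cellIdx
  rw [Int.floor_eq_iff]
  set k := ⌊2 ^ (n + 1) * (θ / (2 * π))⌋ with hk
  have h1 : (k : ℝ) ≤ 2 ^ (n + 1) * (θ / (2 * π)) := Int.floor_le _
  have h2 : 2 ^ (n + 1) * (θ / (2 * π)) < k + 1 := Int.lt_floor_add_one _
  have h3 : (2 : ℝ) * ((k / 2 : ℤ) : ℝ) ≤ k := by
    exact_mod_cast (show 2 * (k / 2) ≤ k by omega)
  have h4 : (k : ℝ) + 1 ≤ 2 * (((k / 2 : ℤ) : ℝ) + 1) := by
    exact_mod_cast (show k + 1 ≤ 2 * (k / 2 + 1) by omega)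
  rw [pow_succ] at h1 h2
  constructor <;> linarith

lemma cellIdx_eq_of_le {m n : ℕ} (h : m ≤ n) {θ t : ℝ} (ht : cellIdx n t = cellIdx n θ) :
    cellIdx m t = cellIdx m θ := by
  induction h with
  | refl => exact ht
  | step _ ih =>
    refine ih ?_
    rw [cellIdx_eq_succ_div, ht, ← cellIdx_eq_succ_div]

lemma cell_subset_cell {m n : ℕ} (h : m ≤ n) (θ : ℝ) : cell n θ ⊆ cell m θ :=
  fun _ ht => cellIdx_eq_of_le h ht

lemma dyAvg_congr (g : ℝ → ℝ≥0∞) {n : ℕ} {θ t : ℝ} (ht : cellIdx n t = cellIdx n θ) :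
    dyAvg g n t = dyAvg g n θ := by
  unfold dyAvg cell
  rw [ht]

lemma measurable_dyAvg (g : ℝ → ℝ≥0∞) (n : ℕ) : Measurable (dyAvg g n) :=
  (measurable_from_top (f := fun j : ℤ => (∫⁻ t in cellIdx n ⁻¹' {j}, g t) /
    ENNReal.ofReal (2 * π / 2 ^ n))).comp (measurable_cellIdx n)

lemma measurable_dyMax (g : ℝ → ℝ≥0∞) : Measurable (dyMax g) :=
  Measurable.iSup fun n => measurable_dyAvg g n

lemma dyAvg_mul_volume (g : ℝ → ℝ≥0∞) (n : ℕ) (θ : ℝ) :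
    dyAvg g n θ * volume (cell n θ) = ∫⁻ t in cell n θ, g t := by
  rw [volume_cell, dyAvg,
    ENNReal.div_mul_cancel (ofReal_cell_length_ne_zero n) ENNReal.ofReal_ne_top]

lemma dyAvg_succ_le (g : ℝ → ℝ≥0∞) (n : ℕ) (θ : ℝ) :
    dyAvg g (n + 1) θ ≤ 2 * dyAvg g n θ := by
  have e : ENNReal.ofReal (2 * π / 2 ^ n) = 2 * ENNReal.ofReal (2 * π / 2 ^ (n + 1)) := by
    rw [← ENNReal.ofReal_ofNat, ← ENNReal.ofReal_mul (by norm_num)]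
    congr 1
    rw [pow_succ]
    field_simp
  have h0 := ofReal_cell_length_ne_zero (n + 1)
  unfold dyAvg
  rw [ENNReal.div_le_iff_le_mul (Or.inl h0) (Or.inl ENNReal.ofReal_ne_top), mul_right_comm, ← e,
    ENNReal.mul_div_cancel (ofReal_cell_length_ne_zero n) ENNReal.ofReal_ne_top]
  exact lintegral_mono_set (cell_subset_cell n.le_succ θ)

/-- The points where the dyadic averages of `g` exceed `c` for the first time at level `n`. -/
def firstExceed (g : ℝ → ℝ≥0∞) (c : ℝ≥0∞) (n : ℕ) : Set ℝ :=
  {θ | c < dyAvg g n θ ∧ ∀ m < n, dyAvg g m θ ≤ c}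

lemma measurableSet_firstExceed (g : ℝ → ℝ≥0∞) (c : ℝ≥0∞) (n : ℕ) :
    MeasurableSet (firstExceed g c n) := by
  refine (measurableSet_lt measurable_const (measurable_dyAvg g n)).inter ?_
  have : {θ | ∀ m < n, dyAvg g m θ ≤ c} = ⋂ m, ⋂ (_ : m < n), {θ | dyAvg g m θ ≤ c} := by
    ext; simp
  change MeasurableSet {θ | ∀ m < n, dyAvg g m θ ≤ c}
  rw [this]
  exact MeasurableSet.iInter fun m => MeasurableSet.iInter fun _ =>
    measurableSet_le (measurable_dyAvg g m) measurable_const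

lemma iUnion_firstExceed (g : ℝ → ℝ≥0∞) (c : ℝ≥0∞) :
    ⋃ n, firstExceed g c n = {θ | c < dyMax g θ} := by
  classical
  ext θ
  simp only [mem_iUnion]
  constructor
  · rintro ⟨n, hn⟩
    exact hn.1.trans_le (le_iSup (fun n => dyAvg g n θ) n)
  · intro h
    have hex : ∃ n, c < dyAvg g n θ := lt_iSup_iff.1 h
    exact ⟨Nat.find hex, Nat.find_spec hex, fun m hm => not_lt.1 (Nat.find_min hex hm)⟩

lemma disjoint_firstExceed (g : ℝ → ℝ≥0∞) (c : ℝ≥0∞) :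
    Pairwise (Function.onFun Disjoint (firstExceed g c)) := by
  intro m n hmn
  refine disjoint_left.2 fun θ hm hn => ?_
  rcases lt_or_gt_of_ne hmn with h | h
  · exact absurd hm.1 (not_lt.2 (hn.2 m h))
  · exact absurd hn.1 (not_lt.2 (hm.2 n h))

lemma setLIntegral_firstExceed_le {g : ℝ → ℝ≥0∞} {c : ℝ≥0∞} (h0 : ∀ θ, dyAvg g 0 θ ≤ c) (n : ℕ) :
    ∫⁻ t in firstExceed g c n, g t ≤ 2 * c * volume (firstExceed g c n) := by
  rcases n with _ | n
  · have : firstExceed g c 0 = ∅ := eq_empty_of_forall_notMem fun θ h => not_lt.2 (h0 θ) h.1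
    simp [this]
  set S := firstExceed g c (n + 1) with hS
  have hSm : MeasurableSet S := measurableSet_firstExceed g c (n + 1)
  have hm : ∀ j : ℤ, MeasurableSet (S ∩ cellIdx (n + 1) ⁻¹' {j}) := fun j =>
    hSm.inter (measurable_cellIdx _ (measurableSet_singleton j))
  have hd : Pairwise (Function.onFun Disjoint fun j : ℤ => S ∩ cellIdx (n + 1) ⁻¹' {j}) := by
    intro i j hij
    exact disjoint_left.2 fun t hi hj => hij (hi.2.symm.trans hj.2)
  have hU : S = ⋃ j : ℤ, S ∩ cellIdx (n + 1) ⁻¹' {j} := by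
    ext t; simp
  have hj : ∀ j : ℤ, ∫⁻ t in S ∩ cellIdx (n + 1) ⁻¹' {j}, g t ≤
      2 * c * volume (S ∩ cellIdx (n + 1) ⁻¹' {j}) := by
    intro j
    rcases eq_empty_or_nonempty (S ∩ cellIdx (n + 1) ⁻¹' {j}) with h | ⟨θ, hθS, hθj⟩
    · simp [h]
    · have hθj' : cellIdx (n + 1) θ = j := hθj
      have e : S ∩ cellIdx (n + 1) ⁻¹' {j} = cell (n + 1) θ := by
        rw [cell, hθj']
        refine inter_eq_right.2 fun t ht => ?_
        have ht' : cellIdx (n + 1) t = cellIdx (n + 1) θ := by rw [hθj']; exact ht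
        refine ⟨?_, fun m hm => ?_⟩
        · rw [dyAvg_congr g ht']; exact hθS.1
        · rw [dyAvg_congr g (cellIdx_eq_of_le hm.le ht')]; exact hθS.2 m hm
      rw [e, ← dyAvg_mul_volume]
      gcongr
      refine (dyAvg_succ_le g n θ).trans ?_
      gcongr
      exact hθS.2 n n.lt_succ_self
  rw [hU, lintegral_iUnion hm hd, measure_iUnion hd hm, ← ENNReal.tsum_mul_left]
  exact ENNReal.tsum_le_tsum hj

lemma setLIntegral_dyMax_le {g : ℝ → ℝ≥0∞} {c : ℝ≥0∞} (h0 : ∀ θ, dyAvg g 0 θ ≤ c) :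
    ∫⁻ t in {θ | c < dyMax g θ}, g t ≤ 2 * c * volume {θ | c < dyMax g θ} := by
  have hm := measurableSet_firstExceed g c
  have hd := disjoint_firstExceed g c
  rw [← iUnion_firstExceed, lintegral_iUnion hm hd, measure_iUnion hd hm, ← ENNReal.tsum_mul_left]
  exact ENNReal.tsum_le_tsum fun n => setLIntegral_firstExceed_le h0 n

lemma ae_le_dyMax {g : ℝ → ℝ≥0∞} (hg : Measurable g) (hfin : ∫⁻ x, g x ≠ ⊤) :
    ∀ᵐ x, g x ≤ dyMax g x := by
  filter_upwards [VitaliFamily.ae_tendsto_lintegral_div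
    (IsUnifLocDoublingMeasure.vitaliFamily (volume : Measure ℝ) 1) hg.aemeasurable hfin] with x hx
  have hlim : Filter.Tendsto (fun n : ℕ => π / 2 ^ n) Filter.atTop (nhdsWithin 0 (Ioi 0)) := by
    refine tendsto_nhdsWithin_iff.2 ⟨?_, Filter.Eventually.of_forall fun n => ?_⟩
    · have h := (tendsto_pow_atTop_nhds_zero_of_lt_one (r := (1 / 2 : ℝ)) (by norm_num)
        (by norm_num)).const_mul π
      rw [mul_zero] at h
      refine h.congr fun n => ?_
      rw [one_div, inv_pow, div_eq_mul_inv]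
    · exact show 0 < π / 2 ^ n by positivity
  have hball : ∀ n, Metric.closedBall (2 * π / 2 ^ n * cellIdx n x + π / 2 ^ n) (π / 2 ^ n) =
      Icc (2 * π / 2 ^ n * cellIdx n x) (2 * π / 2 ^ n * (cellIdx n x + 1)) := fun n => by
    rw [Real.closedBall_eq_Icc]
    congr 1 <;> ring
  have hmem : ∀ n, x ∈ Metric.closedBall (2 * π / 2 ^ n * cellIdx n x + π / 2 ^ n)
      (1 * (π / 2 ^ n)) := fun n => by
    rw [one_mul, hball]
    have h := mem_cell_self n x
    rw [cell_eq_Ico] at h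
    exact Ico_subset_Icc_self h
  have ht := hx.comp (IsUnifLocDoublingMeasure.tendsto_closedBall_filterAt (volume : Measure ℝ)
    (fun n : ℕ => 2 * π / 2 ^ n * cellIdx n x + π / 2 ^ n) (fun n => π / 2 ^ n) hlim
    (Filter.Eventually.of_forall hmem))
  refine le_of_tendsto' ht fun n => ?_
  refine le_trans (le_of_eq ?_) (le_iSup (fun n => dyAvg g n x) n)
  simp only [Function.comp_apply]
  rw [hball, dyAvg, ← volume_cell n x, cell_eq_Ico, restrict_Ico_eq_restrict_Icc,
    Real.volume_Icc, Real.volume_Ico]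

/-- The reverse weak type inequality, integrated against `psiDeriv`. -/
lemma lintegral_mul_primE_le_dyMax {g : ℝ → ℝ≥0∞} (hg : Measurable g) (hfin : ∫⁻ x, g x ≠ ⊤)
    {a : ℝ} (ha : 0 < a) (h0 : ∀ θ, dyAvg g 0 θ ≤ ENNReal.ofReal a) :
    ∫⁻ x, g x * primE (fun l => psiDeriv l / l) a (g x) ≤
      2 * ∫⁻ x, primE psiDeriv a (dyMax g x) := by
  rw [lintegral_primE measurable_psiDeriv a (measurable_dyMax g),
    lintegral_mul_primE (v := fun l => psiDeriv l / l)
      (measurable_psiDeriv.div measurable_id) a hg hg,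
    ← lintegral_const_mul' _ _ ENNReal.ofNat_ne_top]
  refine setLIntegral_mono' measurableSet_Ioi fun l hl => ?_
  have hl0 : 0 < l := ha.trans hl
  rw [ofReal_psiDeriv_eq hl0, mul_assoc, mul_left_comm 2]
  refine mul_le_mul' le_rfl ?_
  have hm : MeasurableSet {x | ENNReal.ofReal l < dyMax g x} :=
    measurableSet_lt measurable_const (measurable_dyMax g)
  rw [← mul_assoc]
  refine le_trans ?_ (setLIntegral_dyMax_le fun θ =>
    (h0 θ).trans (ENNReal.ofReal_le_ofReal (le_of_lt hl)))
  rw [← lintegral_indicator hm]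
  refine lintegral_mono_ae ?_
  filter_upwards [ae_le_dyMax hg hfin] with x hx
  by_cases h : ENNReal.ofReal l < g x
  · rw [indicator_of_mem (by exact h), indicator_of_mem (by exact h.trans_le hx)]
  · rw [indicator_of_notMem (by exact h)]
    exact zero_le

lemma dyAvg_const_mul {c : ℝ≥0∞} (hc : c ≠ ⊤) (g : ℝ → ℝ≥0∞) (n : ℕ) (θ : ℝ) :
    dyAvg (fun t => c * g t) n θ = c * dyAvg g n θ := by
  rw [dyAvg, dyAvg, lintegral_const_mul' _ _ hc, mul_div_assoc]

lemma dyAvg_zero_le (g : ℝ → ℝ≥0∞) (θ : ℝ) : dyAvg g 0 θ ≤ ∫⁻ t, g t := by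
  have h1 : 1 ≤ ENNReal.ofReal (2 * π / 2 ^ 0) := by
    rw [← ENNReal.ofReal_one]
    refine ENNReal.ofReal_le_ofReal ?_
    rw [pow_zero, div_one]
    linarith [Real.pi_gt_three]
  exact (ENNReal.div_le_of_le_mul (le_mul_of_one_le_right zero_le h1)).trans
    (setLIntegral_le_lintegral _ _)

lemma cellIdx_zero_eq_zero_iff (t : ℝ) : cellIdx 0 t = 0 ↔ t ∈ Ico 0 (2 * π) := by
  have hp : 0 < 2 * π := by positivity
  unfold cellIdx
  rw [pow_zero, one_mul, Int.floor_eq_zero_iff, mem_Ico, mem_Ico, div_lt_one hp,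
    le_div_iff₀ hp, zero_mul]

lemma dyMax_indicator_eq_zero {c : ℝ≥0∞} {g : ℝ → ℝ≥0∞} {θ : ℝ} (hθ : θ ∉ Ico 0 (2 * π)) :
    dyMax (fun t => c * (Ico 0 (2 * π)).indicator g t) θ = 0 := by
  refine ENNReal.iSup_eq_zero.2 fun n => ?_
  rw [dyAvg, ENNReal.div_eq_zero_iff]
  left
  refine (setLIntegral_congr_fun (measurableSet_cell n θ) fun t ht => ?_).trans lintegral_zero
  have h : cellIdx 0 t = cellIdx 0 θ := cellIdx_eq_of_le (Nat.zero_le n) ht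
  have ht' : t ∉ Ico 0 (2 * π) := fun h' =>
    hθ ((cellIdx_zero_eq_zero_iff θ).1 (h ▸ (cellIdx_zero_eq_zero_iff t).2 h'))
  simp only [indicator_of_notMem ht', mul_zero]

lemma primE_zero (v : ℝ → ℝ) (a : ℝ) : primE v a 0 = 0 := by
  simp [primE]

lemma distT_self_lt {θ δ : ℝ} (hδ : 0 < δ) : distT θ θ < δ := by
  refine lt_of_le_of_lt (ciInf_le ⟨0, ?_⟩ (0 : ℤ)) (by simpa using hδ)
  rintro _ ⟨n, rfl⟩
  exact abs_nonneg _

lemma le_poisson {n : ℕ} {v : ℝ} (hv : |v| ≤ 2 * π / 2 ^ n) :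
    2 / (1 + 16 * π ^ 2) / (2 * π / 2 ^ n) ≤ poisson (1 - 1 / 2 ^ (n + 1)) v := by
  set δ : ℝ := 1 / 2 ^ (n + 1) with hδ
  have hδ0 : 0 < δ := by positivity
  have hδ1 : δ ≤ 1 := by
    rw [hδ, div_le_one (by positivity)]
    exact one_le_pow₀ (by norm_num)
  have hlen : 2 * π / 2 ^ n = 4 * π * δ := by
    rw [hδ, pow_succ]
    field_simp
    norm_num
  have hpi := Real.pi_pos
  unfold poisson
  rw [hlen] at hv
  rw [poisson_denom_eq, hlen]
  have hs : Real.sin (v / 2) ^ 2 ≤ (v / 2) ^ 2 := by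
    rw [sq_le_sq]
    exact Real.abs_sin_le_abs
  have hv2 : v ^ 2 ≤ (4 * π * δ) ^ 2 := by
    rw [← sq_abs v]
    gcongr
  have hD : (1 - (1 - δ)) ^ 2 + 4 * (1 - δ) * Real.sin (v / 2) ^ 2 ≤ δ ^ 2 * (1 + 16 * π ^ 2) := by
    nlinarith [mul_nonneg hδ0.le (sq_nonneg (Real.sin (v / 2)))]
  have hD0 : 0 < (1 - (1 - δ)) ^ 2 + 4 * (1 - δ) * Real.sin (v / 2) ^ 2 := by
    have : 0 ≤ 4 * (1 - δ) * Real.sin (v / 2) ^ 2 :=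
      mul_nonneg (by linarith) (sq_nonneg _)
    nlinarith
  calc 2 / (1 + 16 * π ^ 2) / (4 * π * δ) = δ / (2 * π * (δ ^ 2 * (1 + 16 * π ^ 2))) := by
        field_simp
        norm_num
    _ ≤ (1 - (1 - δ) ^ 2) / (2 * π * ((1 - (1 - δ)) ^ 2 + 4 * (1 - δ) * Real.sin (v / 2) ^ 2)) := by
        have hδ2 : δ ≤ 1 - (1 - δ) ^ 2 := by nlinarith [mul_nonneg hδ0.le (sub_nonneg.2 hδ1)]
        exact div_le_div₀ (hδ0.le.trans hδ2) hδ2 (by positivity) (by gcongr)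

lemma continuous_poisson {r : ℝ} (h0 : 0 < r) (h1 : r < 1) : Continuous (poisson r) := by
  unfold poisson
  refine continuous_const.div (by fun_prop) fun v => ?_
  rw [poisson_denom_eq]
  have : 0 < (1 - r) ^ 2 := pow_pos (by linarith) 2
  positivity

lemma dyMax_le_nonTanMax {f : ℝ → ℝ} (hf : IntegrableOn f (Ico 0 (2 * π)))
    (hpos : ∀ᵐ θ ∂(volume.restrict (Ico 0 (2 * π))), 0 ≤ f θ) (θ : ℝ) :
    dyMax (fun t => ENNReal.ofReal (2 / (1 + 16 * π ^ 2)) *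
      (Ico 0 (2 * π)).indicator (fun t => ENNReal.ofReal (f t)) t) θ ≤ nonTanMax f θ := by
  refine iSup_le fun n => ?_
  set κ : ℝ := 2 / (1 + 16 * π ^ 2) with hκ
  set r : ℝ := 1 - 1 / 2 ^ (n + 1) with hr
  have hδ0 : (0 : ℝ) < 1 / 2 ^ (n + 1) := by positivity
  have h1 : r < 1 := by linarith
  have h0 : 0 < r := by
    have : (1 : ℝ) / 2 ^ (n + 1) < 1 := by
      rw [div_lt_one (by positivity)]
      exact one_lt_pow₀ (by norm_num) (Nat.succ_ne_zero n)
    linarith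
  have hint : IntegrableOn (fun t => poisson r (θ - t) * f t) (Ico 0 (2 * π)) := by
    rw [← integrableOn_Icc_iff_integrableOn_Ico] at hf ⊢
    have hc : Continuous fun t => poisson r (θ - t) :=
      (continuous_poisson h0 h1).comp (by fun_prop)
    exact hf.continuousOn_mul hc.continuousOn isCompact_Icc
  have hnn : 0 ≤ᵐ[volume.restrict (Ico 0 (2 * π))] fun t => poisson r (θ - t) * f t := by
    filter_upwards [hpos] with t ht
    exact mul_nonneg (poisson_nonneg h0 h1 _) ht
  have hle : ENNReal.ofReal |∫ t in (0 : ℝ)..(2 * π), poisson r (θ - t) * f t| ≤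
      nonTanMax f θ :=
    le_iSup_of_le r <| le_iSup_of_le θ <| le_iSup_of_le h0 <| le_iSup_of_le h1 <|
      le_iSup_of_le (distT_self_lt (by linarith)) le_rfl
  refine le_trans ?_ hle
  rw [intervalIntegral.integral_of_le (by positivity), ← restrict_Ico_eq_restrict_Ioc,
    abs_of_nonneg (integral_nonneg_of_ae hnn), ofReal_integral_eq_lintegral_ofReal hint hnn]
  have hlen : 0 < 2 * π / 2 ^ n := by positivity
  rw [dyAvg_const_mul ENNReal.ofReal_ne_top, dyAvg, setLIntegral_indicator measurableSet_Ico,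
    ← mul_div_assoc, mul_comm, mul_div_assoc, ← ENNReal.ofReal_div_of_pos hlen, mul_comm,
    ← lintegral_const_mul' _ _ ENNReal.ofReal_ne_top]
  have hκ0 : 0 ≤ κ / (2 * π / 2 ^ n) := by positivity
  calc ∫⁻ t in Ico 0 (2 * π) ∩ cell n θ, ENNReal.ofReal (κ / (2 * π / 2 ^ n)) * ENNReal.ofReal (f t)
      ≤ ∫⁻ t in Ico 0 (2 * π) ∩ cell n θ, ENNReal.ofReal (poisson r (θ - t) * f t) := by
        refine setLIntegral_mono' (measurableSet_Ico.inter (measurableSet_cell n θ)) fun t ht => ?_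
        rw [ENNReal.ofReal_mul (poisson_nonneg h0 h1 _)]
        gcongr
        exact le_poisson (abs_sub_le_of_mem_cell ht.2)
    _ ≤ _ := lintegral_mono_set inter_subset_left

theorem lintegral_mul_logPlus_lt_top {f : ℝ → ℝ} (hmeas : Measurable f)
    (hf : IntegrableOn f (Ico 0 (2 * π)))
    (hpos : ∀ᵐ θ ∂(volume.restrict (Ico 0 (2 * π))), 0 ≤ f θ)
    (hH : ∫⁻ θ in Ico 0 (2 * π), psi0E (nonTanMax f θ) < ⊤) :
    ∫⁻ θ in Ico 0 (2 * π), ENNReal.ofReal (f θ * logPlus (logPlus (f θ))) < ⊤ := by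
  set κ : ℝ := 2 / (1 + 16 * π ^ 2) with hκ
  have hκ0 : 0 < κ := by positivity
  set g : ℝ → ℝ≥0∞ := fun t => ENNReal.ofReal κ *
    (Ico 0 (2 * π)).indicator (fun t => ENNReal.ofReal (f t)) t with hgdef
  have hg : Measurable g :=
    (hmeas.ennreal_ofReal.indicator measurableSet_Ico).const_mul _
  have hffin : ∫⁻ θ in Ico 0 (2 * π), ENNReal.ofReal (f θ) < ⊤ :=
    (lintegral_mono fun θ => Real.ofReal_le_enorm (f θ)).trans_lt hf.2
  have hgfin : ∫⁻ x, g x < ⊤ := by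
    rw [hgdef, lintegral_const_mul' _ _ ENNReal.ofReal_ne_top,
      lintegral_indicator measurableSet_Ico]
    exact ENNReal.mul_lt_top ENNReal.ofReal_lt_top hffin
  set a : ℝ := max (Real.exp 2) (∫⁻ x, g x).toReal with ha
  have hae : Real.exp 2 ≤ a := le_max_left _ _
  have ha0 : 0 < a := (Real.exp_pos 2).trans_le hae
  have h0 : ∀ θ, dyAvg g 0 θ ≤ ENNReal.ofReal a := fun θ =>
    (dyAvg_zero_le g θ).trans (by
      rw [← ENNReal.ofReal_toReal hgfin.ne]
      exact ENNReal.ofReal_le_ofReal (le_max_right _ _))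
  have hmain : ∫⁻ x, g x * primE (fun l => psiDeriv l / l) a (g x) < ⊤ := by
    refine (lintegral_mul_primE_le_dyMax hg hgfin.ne ha0 h0).trans_lt
      (ENNReal.mul_lt_top (by simp) ?_)
    have hpt : ∀ x, primE psiDeriv a (dyMax g x) ≤
        (Ico 0 (2 * π)).indicator (fun x => 2 * psi0E (nonTanMax f x)) x := by
      intro x
      by_cases hx : x ∈ Ico 0 (2 * π)
      · rw [indicator_of_mem hx]
        exact (primE_mono _ _ (dyMax_le_nonTanMax hf hpos x)).trans (primE_psiDeriv_le hae _)
      · rw [hgdef, dyMax_indicator_eq_zero hx, primE_zero]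
        exact zero_le
    refine (lintegral_mono hpt).trans_lt ?_
    rw [lintegral_indicator measurableSet_Ico, lintegral_const_mul' _ _ ENNReal.ofNat_ne_top]
    exact ENNReal.mul_lt_top (by simp) hH
  set C : ℝ≥0∞ := ENNReal.ofReal (Real.log 2 + logPlus (logPlus κ⁻¹)) +
    ENNReal.ofReal (logPlus (logPlus a)) with hC
  have hCfin : C < ⊤ := ENNReal.add_lt_top.2 ⟨ENNReal.ofReal_lt_top, ENNReal.ofReal_lt_top⟩
  have hpt : ∀ᵐ θ ∂(volume.restrict (Ico 0 (2 * π))),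
      ENNReal.ofReal (f θ * logPlus (logPlus (f θ))) ≤ C * ENNReal.ofReal (f θ) +
        2 * ENNReal.ofReal κ⁻¹ * (g θ * primE (fun l => psiDeriv l / l) a (g θ)) := by
    filter_upwards [hpos, ae_restrict_mem measurableSet_Ico] with θ hθ hmem
    have e : g θ = ENNReal.ofReal (κ * f θ) := by
      simp only [hgdef, indicator_of_mem hmem]
      rw [ENNReal.ofReal_mul hκ0.le]
    have e2 : ENNReal.ofReal (f θ) = ENNReal.ofReal κ⁻¹ * g θ := by
      rw [e, ← ENNReal.ofReal_mul (by positivity), inv_mul_cancel_left₀ hκ0.ne']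
    have h1 : ENNReal.ofReal (logPlus (logPlus (f θ))) ≤
        C + 2 * primE (fun l => psiDeriv l / l) a (g θ) := by
      have h := logPlus_logPlus_mul_le κ⁻¹ (κ * f θ)
      rw [inv_mul_cancel_left₀ hκ0.ne'] at h
      refine (ENNReal.ofReal_le_ofReal h).trans (ENNReal.ofReal_add_le.trans ?_)
      rw [hC, add_assoc, e]
      gcongr
      exact logPlus_logPlus_le hae (mul_nonneg hκ0.le hθ)
    rw [ENNReal.ofReal_mul hθ]
    refine (mul_le_mul' le_rfl h1).trans (le_of_eq ?_)
    rw [mul_add, mul_comm C]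
    congr 1
    rw [e2]
    ring
  refine (lintegral_mono_ae hpt).trans_lt ?_
  rw [lintegral_add_left (hmeas.ennreal_ofReal.const_mul _), lintegral_const_mul' _ _ hCfin.ne,
    lintegral_const_mul' _ _ (ENNReal.mul_ne_top ENNReal.ofNat_ne_top ENNReal.ofReal_ne_top)]
  exact ENNReal.add_lt_top.2 ⟨ENNReal.mul_lt_top hCfin hffin,
    ENNReal.mul_lt_top (ENNReal.mul_lt_top (by simp) ENNReal.ofReal_lt_top)
      ((setLIntegral_le_lintegral _ _).trans_lt hmain)⟩

/-- (i) `f ∈ L log log L(𝕋)` implies `f ∈ H^log(𝕋)`; (ii) conversely, a nonnegative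
function in `H^log(𝕋)` belongs to `L log log L(𝕋)`. -/
theorem stmt16 (f : ℝ → ℝ) (hmeas : Measurable f) (hf : IntegrableOn f (Ico 0 (2 * π))) :
    ((∫⁻ θ in Ico 0 (2 * π), ENNReal.ofReal (|f θ| * logPlus (logPlus |f θ|))) < ⊤ →
      (∫⁻ θ in Ico 0 (2 * π), psi0E (nonTanMax f θ)) < ⊤) ∧
    ((∀ᵐ θ ∂(volume.restrict (Ico 0 (2 * π))), 0 ≤ f θ) →
      (∫⁻ θ in Ico 0 (2 * π), psi0E (nonTanMax f θ)) < ⊤ →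
      (∫⁻ θ in Ico 0 (2 * π), ENNReal.ofReal (f θ * logPlus (logPlus (f θ)))) < ⊤) := by
  exact ⟨lintegral_psi0E_nonTanMax_lt_top hmeas hf, lintegral_mul_logPlus_lt_top hmeas hf⟩

end
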